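/- Let K ⊆ [0,1] be the Salem-type Cantor set built from N ≥ 2 intervals with contraction ratios η_j increasing to η where N·η^β = 1 and η(1 − 1/(j+1)²) ≤ η_j ≤ η, and let M = K × K × ⋯ × K ⊆ ℝⁿ (n factors). Then the Hausdorff dimension of M equals α = nβ, and moreover 0 < H_α(M) and P^α(M) < ∞. -/

import Mathlib

open Metric Set MeasureTheory Filter ENNReal

/-- The quantity `P^s_ε(A)`: the supremum of `Σ (2 r_k)^s` over all packings of `A`,
i.e. collections of pairwise disjoint open balls with centres in `A` and radii
`0 < r_k ≤ ε/2`. -/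
noncomputable def prePackingAux {X : Type*} [MetricSpace X] (s ε : ℝ) (A : Set X) : ℝ≥0∞ :=
  ⨆ (t : Finset (X × ℝ)) (_ : ∀ p ∈ t, p.1 ∈ A ∧ 0 < p.2 ∧ p.2 ≤ ε / 2)
    (_ : (t : Set (X × ℝ)).Pairwise fun p q =>
      Disjoint (Metric.ball p.1 p.2) (Metric.ball q.1 q.2)),
    ∑ p ∈ t, ENNReal.ofReal ((2 * p.2) ^ s)

/-- The packing premeasure `P^s_0(A) = lim_{ε ↓ 0} P^s_ε(A)`; since `ε ↦ P^s_ε(A)` is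
nondecreasing, the limit is the infimum over `ε > 0`. -/
noncomputable def prePacking {X : Type*} [MetricSpace X] (s : ℝ) (A : Set X) : ℝ≥0∞ :=
  ⨅ (ε : ℝ) (_ : 0 < ε), prePackingAux s ε A

/-- The packing `s`-measure `P^s(A) = inf {Σ_i P^s_0(A_i) : A = ∪_i A_i}`. -/
noncomputable def packingMeasure {X : Type*} [MetricSpace X] (s : ℝ) (A : Set X) : ℝ≥0∞ :=
  ⨅ (c : ℕ → Set X) (_ : A ⊆ ⋃ i, c i), ∑' i, prePacking s (c i)

/-- The product `η₁ η₂ ⋯ η_j` of the first `j` contraction ratios. -/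
noncomputable def ratioProd (ηs : ℕ → ℝ) (j : ℕ) : ℝ :=
  ∏ m ∈ Finset.range j, ηs (m + 1)

/-- The `j`-th stage `K_j` of the Salem-type Cantor construction: the union of the
`N^j` intervals `[∑ a_{w i} η₁⋯η_i , ∑ a_{w i} η₁⋯η_i + η₁⋯η_j]` over all words
`w : Fin j → Fin N`. -/
noncomputable def salemStage (N : ℕ) (a : Fin N → ℝ) (ηs : ℕ → ℝ) (j : ℕ) : Set ℝ :=
  {x | ∃ w : Fin j → Fin N,
    x ∈ Set.Icc (∑ i : Fin j, a (w i) * ratioProd ηs (i : ℕ))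
      ((∑ i : Fin j, a (w i) * ratioProd ηs (i : ℕ)) + ratioProd ηs j)}

/-- The Salem-type Cantor set `K = ⋂_j K_j`. -/
noncomputable def salemSet (N : ℕ) (a : Fin N → ℝ) (ηs : ℕ → ℝ) : Set ℝ :=
  ⋂ j, salemStage N a ηs j

/-- The `n`-fold cartesian product `M = K × ⋯ × K ⊆ ℝⁿ`. -/
noncomputable def salemCube (n N : ℕ) (a : Fin N → ℝ) (ηs : ℕ → ℝ) :
    Set (EuclideanSpace ℝ (Fin n)) :=
  {x | ∀ i, x i ∈ salemSet N a ηs}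


namespace SalemAux

/-- Partial sums of the coding map. -/
noncomputable def pS {N : ℕ} (a : Fin N → ℝ) (ηs : ℕ → ℝ) (v : ℕ → Fin N) (j : ℕ) : ℝ :=
  ∑ i ∈ Finset.range j, a (v i) * ratioProd ηs i

/-- The coding map. -/
noncomputable def code {N : ℕ} (a : Fin N → ℝ) (ηs : ℕ → ℝ) (v : ℕ → Fin N) : ℝ :=
  ⨆ j, pS a ηs v j

lemma ratioProd_succ (ηs : ℕ → ℝ) (j : ℕ) :
    ratioProd ηs (j + 1) = ratioProd ηs j * ηs (j + 1) := by
  simp [ratioProd, Finset.prod_range_succ]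

lemma ratioProd_pos {ηs : ℕ → ℝ} (h : ∀ j, 0 < ηs j) (j : ℕ) : 0 < ratioProd ηs j :=
  Finset.prod_pos fun _ _ => h _

lemma ratioProd_le {ηs : ℕ → ℝ} {η : ℝ} (h : ∀ j, 0 < ηs j) (hub : ∀ j, ηs j ≤ η) (j : ℕ) :
    ratioProd ηs j ≤ η ^ j := by
  induction j with
  | zero => simp [ratioProd]
  | succ j ih =>
    rw [ratioProd_succ, pow_succ]
    have := ratioProd_pos h j
    exact mul_le_mul ih (hub _) (h _).le (this.le.trans ih)

lemma le_ratioProd {ηs : ℕ → ℝ} {η : ℝ} (hη : 0 < η) (h : ∀ j, 0 < ηs j)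
    (hlb : ∀ j : ℕ, η * (1 - 1 / ((j : ℝ) + 1) ^ 2) ≤ ηs j) (j : ℕ) :
    η ^ j * (((j : ℝ) + 2) / (2 * ((j : ℝ) + 1))) ≤ ratioProd ηs j := by
  induction j with
  | zero => simp [ratioProd]
  | succ j ih =>
    rw [ratioProd_succ]
    have h1 := hlb (j + 1)
    have h2 := h (j + 1)
    refine le_trans (le_of_eq ?_) (mul_le_mul ih h1 ?_ (ratioProd_pos h j).le)
    · push_cast
      field_simp
      ring
    · apply mul_nonneg hη.le
      rw [sub_nonneg, div_le_one (by positivity)]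
      push_cast
      nlinarith [(Nat.cast_nonneg j : (0 : ℝ) ≤ j)]

lemma half_le_ratioProd {ηs : ℕ → ℝ} {η : ℝ} (hη : 0 < η) (h : ∀ j, 0 < ηs j)
    (hlb : ∀ j : ℕ, η * (1 - 1 / ((j : ℝ) + 1) ^ 2) ≤ ηs j) (j : ℕ) :
    η ^ j / 2 ≤ ratioProd ηs j := by
  refine le_trans ?_ (le_ratioProd hη h hlb j)
  rw [div_eq_mul_one_div]
  gcongr ?_ * ?_
  rw [div_le_div_iff₀ (by positivity) (by positivity)]
  linarith

section
variable {N : ℕ} {a : Fin N → ℝ} {ηs : ℕ → ℝ} {η : ℝ}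

lemma pS_succ (v : ℕ → Fin N) (j : ℕ) :
    pS a ηs v (j + 1) = pS a ηs v j + a (v j) * ratioProd ηs j := by
  simp [pS, Finset.sum_range_succ]

lemma pS_congr {v u : ℕ → Fin N} {j : ℕ} (h : ∀ i < j, v i = u i) :
    pS a ηs v j = pS a ηs u j :=
  Finset.sum_congr rfl fun i hi => by rw [h i (Finset.mem_range.1 hi)]

lemma pS_mono (ha0 : ∀ k, 0 ≤ a k) (h : ∀ j, 0 < ηs j) (v : ℕ → Fin N) :
    Monotone (pS a ηs v) := by
  refine monotone_nat_of_le_succ fun j => ?_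
  rw [pS_succ]
  have := mul_nonneg (ha0 (v j)) (ratioProd_pos h j).le
  linarith

lemma pS_anti (ha1 : ∀ k, a k ≤ 1 - η) (h : ∀ j, 0 < ηs j) (hub : ∀ j, ηs j ≤ η)
    (v : ℕ → Fin N) : Antitone (fun j => pS a ηs v j + ratioProd ηs j) := by
  refine antitone_nat_of_succ_le fun j => ?_
  simp only [pS_succ, ratioProd_succ]
  have h1 := ratioProd_pos h j
  have h2 := ha1 (v j)
  have h3 := hub (j + 1)
  nlinarith

lemma pS_le_pS (ha0 : ∀ k, 0 ≤ a k) (ha1 : ∀ k, a k ≤ 1 - η) (h : ∀ j, 0 < ηs j)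
    (hub : ∀ j, ηs j ≤ η) (v : ℕ → Fin N) (i j : ℕ) :
    pS a ηs v i ≤ pS a ηs v j + ratioProd ηs j := by
  have h1 := pS_mono ha0 h v (le_max_left i j)
  have h2 := pS_anti ha1 h hub v (le_max_right i j)
  have h3 := ratioProd_pos h (max i j)
  simp only at h2
  linarith

lemma code_mem (ha0 : ∀ k, 0 ≤ a k) (ha1 : ∀ k, a k ≤ 1 - η) (h : ∀ j, 0 < ηs j)
    (hub : ∀ j, ηs j ≤ η) (v : ℕ → Fin N) (j : ℕ) :
    code a ηs v ∈ Icc (pS a ηs v j) (pS a ηs v j + ratioProd ηs j) := by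
  have hb := fun i => pS_le_pS ha0 ha1 h hub v i j
  exact ⟨le_ciSup (f := pS a ηs v) ⟨_, by rintro _ ⟨i, rfl⟩; exact hb i⟩ j, ciSup_le hb⟩

lemma mem_stage_of (v : ℕ → Fin N) (j : ℕ) {x : ℝ}
    (hx : x ∈ Icc (pS a ηs v j) (pS a ηs v j + ratioProd ηs j)) : x ∈ salemStage N a ηs j := by
  refine ⟨fun i => v i, ?_⟩
  rw [Fin.sum_univ_eq_sum_range (fun i => a (v i) * ratioProd ηs i)]
  exact hx

lemma exists_of_mem_stage (z : Fin N) (j : ℕ) {x : ℝ} (hx : x ∈ salemStage N a ηs j) :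
    ∃ v : ℕ → Fin N, x ∈ Icc (pS a ηs v j) (pS a ηs v j + ratioProd ηs j) := by
  obtain ⟨w, hw⟩ := hx
  refine ⟨fun k => if hk : k < j then w ⟨k, hk⟩ else z, ?_⟩
  unfold pS
  rw [← Fin.sum_univ_eq_sum_range
    (fun i => a (if hk : i < j then w ⟨i, hk⟩ else z) * ratioProd ηs i)]
  simpa using hw

lemma code_mem_set (ha0 : ∀ k, 0 ≤ a k) (ha1 : ∀ k, a k ≤ 1 - η) (h : ∀ j, 0 < ηs j)
    (hub : ∀ j, ηs j ≤ η) (v : ℕ → Fin N) : code a ηs v ∈ salemSet N a ηs :=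
  mem_iInter.2 fun j => mem_stage_of v j (code_mem ha0 ha1 h hub v j)

lemma exists_gap (hsep : ∀ k l, k ≠ l → η < |a k - a l|) :
    ∃ δ : ℝ, 0 < δ ∧ ∀ k l, k ≠ l → η + δ ≤ |a k - a l| := by
  classical
  have : ∀ᶠ δ : ℝ in nhdsWithin 0 (Ioi 0), ∀ k l, k ≠ l → η + δ ≤ |a k - a l| := by
    refine eventually_all.2 fun k => eventually_all.2 fun l => ?_
    by_cases hkl : k = l
    · simp [hkl]
    · have := hsep k l hkl
      filter_upwards [Ioo_mem_nhdsGT (sub_pos.2 this)] with δ hδ _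
      linarith [hδ.2]
  obtain ⟨δ, h1, h2⟩ := (this.and self_mem_nhdsWithin).exists
  exact ⟨δ, h2, h1⟩

lemma code_sep (ha0 : ∀ k, 0 ≤ a k) (ha1 : ∀ k, a k ≤ 1 - η) (h : ∀ j, 0 < ηs j)
    (hub : ∀ j, ηs j ≤ η) {δ : ℝ} (hδ : ∀ k l, k ≠ l → η + δ ≤ |a k - a l|)
    {v u : ℕ → Fin N} {j : ℕ} (hlt : ∀ i < j, v i = u i) (hne : v j ≠ u j) :
    δ * ratioProd ηs j ≤ |code a ηs v - code a ηs u| := by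
  have h1 := code_mem ha0 ha1 h hub v (j + 1)
  have h2 := code_mem ha0 ha1 h hub u (j + 1)
  rw [pS_succ, ratioProd_succ] at h1 h2
  rw [← pS_congr hlt] at h2
  have h3 := ratioProd_pos h j
  have h4 := hub (j + 1)
  have h5 := hδ _ _ hne
  obtain ⟨h11, h12⟩ := h1
  obtain ⟨h21, h22⟩ := h2
  rcases le_abs.1 h5 with h5 | h5
  · refine le_trans ?_ (le_abs_self _)
    nlinarith
  · refine le_trans ?_ (neg_le_abs _)
    nlinarith

lemma code_injective (ha0 : ∀ k, 0 ≤ a k) (ha1 : ∀ k, a k ≤ 1 - η) (h : ∀ j, 0 < ηs j)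
    (hub : ∀ j, ηs j ≤ η) {δ : ℝ} (hδ0 : 0 < δ) (hδ : ∀ k l, k ≠ l → η + δ ≤ |a k - a l|) :
    Function.Injective (code a ηs) := by
  intro v u hvu
  by_contra hne
  have := code_sep (v := v) (u := u) (j := PiNat.firstDiff v u) ha0 ha1 h hub hδ
    (fun i hi => PiNat.apply_eq_of_lt_firstDiff (E := fun _ => Fin N) hi)
    (PiNat.apply_firstDiff_ne (E := fun _ => Fin N) hne)
  rw [hvu, sub_self, abs_zero] at this
  have := mul_pos hδ0 (ratioProd_pos h (PiNat.firstDiff v u))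
  linarith

end

lemma pow_rpow_eq {N : ℕ} {β η : ℝ} (hη0 : 0 < η) (hNηβ : (N : ℝ) * η ^ β = 1) (j : ℕ) :
    (η ^ j) ^ β = ((N : ℝ) ^ j)⁻¹ := by
  rw [← Real.rpow_natCast, ← Real.rpow_mul hη0.le, mul_comm, Real.rpow_mul hη0.le,
    Real.rpow_natCast, eq_inv_of_mul_eq_one_right hNηβ, inv_pow]

lemma dist_le_of_coord {n : ℕ} (hn : 0 < n) {x y : EuclideanSpace ℝ (Fin n)} {c : ℝ} (hc : 0 ≤ c)
    (h : ∀ i, |x i - y i| ≤ c) : dist x y ≤ n * c := by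
  rw [EuclideanSpace.dist_eq]
  apply Real.sqrt_le_iff.2
  refine ⟨by positivity, ?_⟩
  calc ∑ i, dist (x i) (y i) ^ 2 ≤ ∑ i : Fin n, c ^ 2 := by
        gcongr with i
        rw [Real.dist_eq]; exact h i
    _ = n * c ^ 2 := by simp
    _ ≤ (n * c) ^ 2 := by
      have : (1 : ℝ) ≤ n := by exact_mod_cast hn
      nlinarith [sq_nonneg c, mul_nonneg (sub_nonneg.2 this) (sq_nonneg c)]

lemma holder_one {N : ℕ} {β η : ℝ} {a : Fin N → ℝ} {ηs : ℕ → ℝ} (hβ0 : 0 < β)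
    (hη0 : 0 < η) (hNηβ : (N : ℝ) * η ^ β = 1) (ha0 : ∀ k, 0 ≤ a k) (ha1 : ∀ k, a k ≤ 1 - η)
    (h : ∀ j, 0 < ηs j) (hub : ∀ j, ηs j ≤ η)
    (hlb : ∀ j : ℕ, η * (1 - 1 / ((j : ℝ) + 1) ^ 2) ≤ ηs j)
    {δ : ℝ} (hδ0 : 0 < δ) (hδ : ∀ k l, k ≠ l → η + δ ≤ |a k - a l|) (v u : ℕ → Fin N) :
    |Real.ofDigits v - Real.ofDigits u| ≤ (2 / δ) ^ β * |code a ηs v - code a ηs u| ^ β := by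
  by_cases hvu : v = u
  · subst hvu; simp; positivity
  have h1 := code_sep (v := v) (u := u) (j := PiNat.firstDiff v u) ha0 ha1 h hub hδ
    (fun i hi => PiNat.apply_eq_of_lt_firstDiff (E := fun _ => Fin N) hi)
    (PiNat.apply_firstDiff_ne (E := fun _ => Fin N) hvu)
  have h2 := Real.abs_ofDigits_sub_ofDigits_le (x := v) (y := u)
    (fun i (hi : i < PiNat.firstDiff v u) =>
      PiNat.apply_eq_of_lt_firstDiff (E := fun _ => Fin N) hi)
  generalize PiNat.firstDiff v u = j at *
  refine h2.trans ?_
  rw [← pow_rpow_eq hη0 hNηβ, ← Real.mul_rpow (by positivity) (by positivity)]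
  gcongr
  have h3 := half_le_ratioProd hη0 h hlb j
  calc η ^ j = 2 / δ * (δ * (η ^ j / 2)) := by field_simp
    _ ≤ 2 / δ * (δ * ratioProd ηs j) := by gcongr
    _ ≤ _ := by gcongr

lemma hausdorff_pos
    (n N : ℕ) (hN : 2 ≤ N) (β η : ℝ) (hβ0 : 0 < β)
    (hη0 : 0 < η) (hNηβ : (N : ℝ) * η ^ β = 1)
    (a : Fin N → ℝ) (ha0 : ∀ k, 0 ≤ a k) (ha1 : ∀ k, a k ≤ 1 - η)
    (hsep : ∀ k l, k ≠ l → η < |a k - a l|)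
    (ηs : ℕ → ℝ) (hηpos : ∀ j, 0 < ηs j)
    (hηlb : ∀ j : ℕ, η * (1 - 1 / ((j : ℝ) + 1) ^ 2) ≤ ηs j) (hηub : ∀ j, ηs j ≤ η) :
    0 < μH[(n : ℝ) * β] (salemCube n N a ηs) := by
  obtain ⟨δ, hδ0, hδ⟩ := exists_gap hsep
  have hinj := code_injective ha0 ha1 hηpos hηub hδ0 hδ
  have : Nonempty (Fin N) := ⟨⟨0, by omega⟩⟩
  set T : Set (EuclideanSpace ℝ (Fin n)) := {x | ∀ i, x i ∈ range (code a ηs)} with hT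
  have hTM : T ⊆ salemCube n N a ηs := by
    intro x hx i
    obtain ⟨v, hv⟩ := hx i
    rw [← hv]
    exact code_mem_set ha0 ha1 hηpos hηub v
  set F : EuclideanSpace ℝ (Fin n) → (Fin n → ℝ) :=
    fun x i => Real.ofDigits (Function.invFun (code a ηs) (x i)) with hF
  have hH : HolderOnWith (Real.toNNReal ((2 / δ) ^ β)) (Real.toNNReal β) F T := by
    intro x hx y hy
    rw [edist_pi_le_iff]
    intro i
    obtain ⟨v, hv⟩ := hx i
    obtain ⟨u, hu⟩ := hy i
    have h1 := holder_one hβ0 hη0 hNηβ ha0 ha1 hηpos hηub hηlb hδ0 hδ v u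
    have e1 : F x i = Real.ofDigits v := by
      simp only [hF]; rw [← hv, Function.leftInverse_invFun hinj]
    have e2 : F y i = Real.ofDigits u := by
      simp only [hF]; rw [← hu, Function.leftInverse_invFun hinj]
    have h2 : |x i - y i| ≤ dist x y := by
      have := PiLp.norm_apply_le (x - y) i
      rw [dist_eq_norm]; simpa using this
    rw [hv, hu] at h1
    rw [e1, e2, edist_dist, edist_dist, Real.dist_eq, Real.coe_toNNReal _ hβ0.le,
      ENNReal.ofReal_rpow_of_nonneg dist_nonneg hβ0.le]
    change _ ≤ ENNReal.ofReal _ * _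
    rw [← ENNReal.ofReal_mul (by positivity)]
    apply ENNReal.ofReal_le_ofReal
    refine h1.trans ?_
    gcongr
  have hle := hH.hausdorffMeasure_image_le (Real.toNNReal_pos.2 hβ0) (d := (n : ℝ))
    (Nat.cast_nonneg n)
  rw [Real.coe_toNNReal _ hβ0.le, mul_comm β] at hle
  have hsub : (Set.pi univ fun _ : Fin n => Icc (0 : ℝ) 1) ⊆ F '' T := by
    intro y hy
    have : ∀ i, ∃ v : ℕ → Fin N, Real.ofDigits v = y i := fun i => by
      obtain ⟨v, -, hv⟩ := Real.ofDigits_SurjOn (b := N) (by omega) (hy i (mem_univ i))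
      exact ⟨v, hv⟩
    choose v hv using this
    refine ⟨WithLp.toLp 2 fun i => code a ηs (v i), fun i => ⟨v i, rfl⟩, ?_⟩
    funext i
    simp only [hF]
    rw [Function.leftInverse_invFun hinj, hv]
  have hvol : (1 : ℝ≥0∞) ≤ μH[(n : ℝ)] (F '' T) := by
    refine le_trans (le_of_eq ?_) (measure_mono hsub)
    have := hausdorffMeasure_pi_real (ι := Fin n)
    rw [Fintype.card_fin] at this
    rw [this, volume_pi_pi]
    simp
  refine pos_iff_ne_zero.2 fun h0 => ?_
  have h0' : μH[(n : ℝ) * β] T = 0 := measure_mono_null hTM h0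
  rw [h0', mul_zero] at hle
  exact absurd (hvol.trans hle) (by simp)

lemma hausdorff_lt_top
    (n N : ℕ) (hn : 0 < n) (β η : ℝ) (hβ0 : 0 < β)
    (hη0 : 0 < η) (hη1 : η < 1) (hNηβ : (N : ℝ) * η ^ β = 1)
    (a : Fin N → ℝ)
    (ηs : ℕ → ℝ) (hηpos : ∀ j, 0 < ηs j) (hηub : ∀ j, ηs j ≤ η) :
    μH[(n : ℝ) * β] (salemCube n N a ηs) < ⊤ := by
  have hN0 : (N : ℝ) ≠ 0 := by rintro h; rw [h] at hNηβ; simp at hNηβ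
  let t : ∀ j : ℕ, (Fin n → Fin j → Fin N) → Set (EuclideanSpace ℝ (Fin n)) := fun j w =>
    {x | ∀ i, x i ∈ Set.Icc (∑ k : Fin j, a (w i k) * ratioProd ηs (k : ℕ))
      ((∑ k : Fin j, a (w i k) * ratioProd ηs (k : ℕ)) + ratioProd ηs j)}
  have hdiam : ∀ j w, ediam (t j w) ≤ ENNReal.ofReal (n * η ^ j) := by
    intro j w
    refine Metric.ediam_le fun x hx y hy => ?_
    rw [edist_dist]
    apply ENNReal.ofReal_le_ofReal
    refine dist_le_of_coord hn (by positivity) fun i => ?_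
    have h1 := hx i
    have h2 := hy i
    have h3 := ratioProd_le hηpos hηub j
    rw [abs_le]
    constructor <;> linarith [h1.1, h1.2, h2.1, h2.2]
  have hlim : Tendsto (fun j : ℕ => ENNReal.ofReal (n * η ^ j)) atTop (nhds 0) := by
    rw [← ENNReal.ofReal_zero]
    apply ENNReal.tendsto_ofReal
    simpa using (tendsto_pow_atTop_nhds_zero_of_lt_one hη0.le hη1).const_mul (n : ℝ)
  have hcov : ∀ j, salemCube n N a ηs ⊆ ⋃ w, t j w := by
    intro j x hx
    have : ∀ i, x i ∈ salemStage N a ηs j := fun i => mem_iInter.1 (hx i) j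
    choose w hw using this
    exact mem_iUnion.2 ⟨w, hw⟩
  have hle := Measure.hausdorffMeasure_le_liminf_sum ((n : ℝ) * β) (salemCube n N a ηs)
    (l := atTop) _ hlim t (Eventually.of_forall hdiam) (Eventually.of_forall hcov)
  have hsum : ∀ j, ∑ w, ediam (t j w) ^ ((n : ℝ) * β)
      ≤ ENNReal.ofReal ((n : ℝ) ^ ((n : ℝ) * β)) := by
    intro j
    calc ∑ w, ediam (t j w) ^ ((n : ℝ) * β)
        ≤ ∑ w : Fin n → Fin j → Fin N, ENNReal.ofReal (n * η ^ j) ^ ((n : ℝ) * β) := by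
          gcongr with w
          exact hdiam j w
      _ = ENNReal.ofReal (((N : ℝ) ^ j) ^ n * (n * η ^ j) ^ ((n : ℝ) * β)) := by
          rw [ENNReal.ofReal_rpow_of_nonneg (by positivity) (by positivity)]
          rw [ENNReal.ofReal_mul (by positivity)]
          simp [ENNReal.ofReal_pow]
      _ = _ := by
          congr 1
          rw [Real.mul_rpow (by positivity) (by positivity), mul_comm (n : ℝ) β,
            Real.rpow_mul (x := η ^ j) (by positivity), pow_rpow_eq hη0 hNηβ, Real.rpow_natCast, mul_left_comm,
            ← mul_pow, mul_inv_cancel₀ (pow_ne_zero _ hN0), one_pow, mul_one]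
  refine (hle.trans ?_).trans_lt (ENNReal.ofReal_lt_top (r := (n : ℝ) ^ ((n : ℝ) * β)))
  refine (liminf_le_liminf (Eventually.of_forall hsum)).trans ?_
  simp

lemma card_cyl (N J j : ℕ) (hj : j ≤ J) :
    (∏ k : Fin J, (if (k : ℕ) < j then 1 else N)) * N ^ j = N ^ J := by
  rw [Fin.prod_univ_eq_prod_range (fun k => if k < j then 1 else N)]
  obtain ⟨d, rfl⟩ := Nat.exists_eq_add_of_le hj
  rw [Finset.prod_range_add, Finset.prod_eq_one, pow_add]
  · simp [mul_comm]
  · intro k hk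
    simp [Finset.mem_range.1 hk]

lemma packing_bound
    (n N : ℕ) (hn : 0 < n) (hN : 2 ≤ N) (β η : ℝ) (hβ0 : 0 < β)
    (hη0 : 0 < η) (hη1 : η < 1) (hNηβ : (N : ℝ) * η ^ β = 1)
    (a : Fin N → ℝ) (ha0 : ∀ k, 0 ≤ a k) (ha1 : ∀ k, a k ≤ 1 - η)
    (ηs : ℕ → ℝ) (hηpos : ∀ j, 0 < ηs j) (hηub : ∀ j, ηs j ≤ η)
    (t : Finset (EuclideanSpace ℝ (Fin n) × ℝ))
    (ht : ∀ p ∈ t, p.1 ∈ salemCube n N a ηs ∧ 0 < p.2 ∧ p.2 ≤ 1 / 2)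
    (hd : (t : Set (EuclideanSpace ℝ (Fin n) × ℝ)).Pairwise fun p q =>
      Disjoint (Metric.ball p.1 p.2) (Metric.ball q.1 q.2)) :
    ∑ p ∈ t, (2 * p.2) ^ ((n : ℝ) * β) ≤ (2 * n / η) ^ ((n : ℝ) * β) := by
  classical
  have hN0 : (0 : ℝ) < N := by exact_mod_cast (by omega : 0 < N)
  have hn1 : (1 : ℝ) ≤ n := by exact_mod_cast hn
  let z : Fin N := ⟨0, by omega⟩
  have : Nonempty (Fin N) := ⟨z⟩
  -- choose levels and words
  have key : ∀ p ∈ t, ∃ j : ℕ, ∃ u : Fin n → ℕ → Fin N, n * η ^ j < p.2 ∧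
      2 * p.2 ≤ 2 * n / η * η ^ j ∧
      ∀ i, p.1 i ∈ Icc (pS a ηs (u i) j) (pS a ηs (u i) j + ratioProd ηs j) := by
    intro p hp
    obtain ⟨hpM, hp0, hp1⟩ := ht p hp
    have hex : ∃ j : ℕ, n * η ^ j < p.2 := by
      obtain ⟨j, hj⟩ := exists_pow_lt_of_lt_one (div_pos hp0 (by linarith : (0 : ℝ) < n)) hη1
      exact ⟨j, by rwa [lt_div_iff₀' (by linarith)] at hj⟩
    have hj := Nat.find_spec hex
    have hmin : ∀ m, m < Nat.find hex → p.2 ≤ n * η ^ m :=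
      fun m hm => not_lt.1 (Nat.find_min hex hm)
    generalize Nat.find hex = j at hj hmin
    have hst : ∀ i, p.1 i ∈ salemStage N a ηs j := fun i => mem_iInter.1 (hpM i) j
    choose u hu using fun i => exists_of_mem_stage z j (hst i)
    refine ⟨j, u, hj, ?_, hu⟩
    rcases j with _ | m
    · simp at hj; linarith
    · have := hmin m (Nat.lt_succ_self m)
      have e : 2 * n / η * η ^ (m + 1) = 2 * (n * η ^ m) := by
        rw [pow_succ]; field_simp
      rw [e]; linarith
  choose! j u hj1 hj2 hu using key
  set J := t.sup j with hJ
  have hjJ : ∀ p ∈ t, j p ≤ J := fun p hp => Finset.le_sup hp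
  let A : EuclideanSpace ℝ (Fin n) × ℝ → Finset (Fin n → Fin J → Fin N) := fun p =>
    Fintype.piFinset fun i => Fintype.piFinset fun k : Fin J =>
      if (k : ℕ) < j p then {u p i k} else Finset.univ
  have hAcard : ∀ p ∈ t, (A p).card * (N ^ j p) ^ n = (N ^ J) ^ n := by
    intro p hp
    have : (A p).card = (∏ k : Fin J, (if (k : ℕ) < j p then 1 else N)) ^ n := by
      simp only [A, Fintype.card_piFinset]
      have e : ∀ (i : Fin n) (k : Fin J),
          (if (k : ℕ) < j p then ({u p i k} : Finset (Fin N)) else Finset.univ).card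
            = if (k : ℕ) < j p then 1 else N := by
        intro i k
        split_ifs <;> simp
      simp only [e, Finset.prod_const, Finset.card_univ, Fintype.card_fin]
    rw [this, ← mul_pow, card_cyl N J _ (hjJ p hp)]
  have hball : ∀ p ∈ t, ∀ w ∈ A p, (WithLp.toLp 2 fun i => pS a ηs
      (fun k => if hk : k < J then w i ⟨k, hk⟩ else z) J : EuclideanSpace ℝ (Fin n))
        ∈ Metric.ball p.1 p.2 := by
    intro p hp w hw
    rw [Metric.mem_ball]
    refine (dist_le_of_coord hn (c := η ^ j p) (by positivity) fun i => ?_).trans_lt (hj1 p hp)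
    simp only
    set v : ℕ → Fin N := fun k => if hk : k < J then w i ⟨k, hk⟩ else z with hv
    have hvu : ∀ k < j p, v k = u p i k := by
      intro k hk
      have hkJ := hk.trans_le (hjJ p hp)
      have h1 := Fintype.mem_piFinset.1 (Fintype.mem_piFinset.1 hw i) ⟨k, hkJ⟩
      simp only [hk, if_true, Finset.mem_singleton] at h1
      simp only [hv, hkJ, dif_pos, h1]
    have h1 := pS_mono ha0 hηpos v (hjJ p hp)
    have h2 := pS_le_pS ha0 ha1 hηpos hηub v J (j p)
    rw [pS_congr hvu] at h1 h2
    have h3 := hu p hp i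
    have h4 := ratioProd_le hηpos hηub (j p)
    rw [abs_le]
    constructor <;> linarith [h3.1, h3.2]
  have hdisj : (t : Set (EuclideanSpace ℝ (Fin n) × ℝ)).PairwiseDisjoint A := by
    intro p hp q hq hpq
    rw [Function.onFun, Finset.disjoint_left]
    intro w hwp hwq
    exact Set.disjoint_left.1 (hd hp hq hpq) (hball p hp w hwp) (hball q hq w hwq)
  have hcard : ∑ p ∈ t, (A p).card ≤ (N ^ J) ^ n := by
    rw [← Finset.card_biUnion hdisj]
    refine (Finset.card_le_univ _).trans (le_of_eq ?_)
    simp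
  have hsum1 : ∑ p ∈ t, (((N : ℝ) ^ j p)⁻¹) ^ n ≤ 1 := by
    have e : ∀ p ∈ t, (((N : ℝ) ^ j p)⁻¹) ^ n = (A p).card / ((N : ℝ) ^ J) ^ n := by
      intro p hp
      have : ((A p).card : ℝ) * ((N : ℝ) ^ j p) ^ n = ((N : ℝ) ^ J) ^ n := by
        exact_mod_cast hAcard p hp
      rw [← this, inv_pow]
      have : ((A p).card : ℝ) ≠ 0 := by
        intro h0
        rw [h0, zero_mul] at this
        have : (0 : ℝ) < ((N : ℝ) ^ J) ^ n := by positivity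
        linarith
      field_simp
    rw [Finset.sum_congr rfl e, ← Finset.sum_div, div_le_one (by positivity)]
    exact_mod_cast hcard
  calc ∑ p ∈ t, (2 * p.2) ^ ((n : ℝ) * β)
      ≤ ∑ p ∈ t, (2 * n / η) ^ ((n : ℝ) * β) * (((N : ℝ) ^ j p)⁻¹) ^ n := by
        refine Finset.sum_le_sum fun p hp => ?_
        have hp0 := (ht p hp).2.1
        refine (Real.rpow_le_rpow (by positivity) (hj2 p hp) (by positivity)).trans (le_of_eq ?_)
        rw [Real.mul_rpow (by positivity) (by positivity), ← pow_rpow_eq hη0 hNηβ,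
          mul_comm (n : ℝ) β, Real.rpow_mul (x := η ^ j p) (by positivity), Real.rpow_natCast]
    _ ≤ (2 * n / η) ^ ((n : ℝ) * β) * 1 := by
        rw [← Finset.mul_sum]; gcongr
    _ = _ := mul_one _

lemma prePacking_empty {X : Type*} [MetricSpace X] (s : ℝ) : prePacking s (∅ : Set X) = 0 := by
  refine le_antisymm ?_ bot_le
  refine (iInf₂_le 1 one_pos).trans ?_
  refine iSup_le fun t => iSup_le fun h1 => iSup_le fun _ => ?_
  rw [Finset.eq_empty_of_forall_notMem fun p hp => (h1 p hp).1]
  simp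

lemma packingMeasure_le {X : Type*} [MetricSpace X] (s : ℝ) (A : Set X) :
    packingMeasure s A ≤ prePacking s A := by
  refine (iInf₂_le (fun i : ℕ => if i = 0 then A else ∅) ?_).trans (le_of_eq ?_)
  · intro x hx
    exact mem_iUnion.2 ⟨0, by simpa using hx⟩
  · rw [tsum_eq_single 0]
    · simp
    · intro i hi
      simp [hi, prePacking_empty]

end SalemAux

theorem salemCube_dimH_and_packingMeasure
    (n N : ℕ) (hn : 0 < n) (hN : 2 ≤ N) (β η : ℝ) (hβ0 : 0 < β) (hβ1 : β < 1)
    (hη0 : 0 < η) (hNη : (N : ℝ) * η < 1) (hNηβ : (N : ℝ) * η ^ β = 1)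
    (a : Fin N → ℝ) (ha0 : ∀ k, 0 ≤ a k) (ha1 : ∀ k, a k ≤ 1 - η)
    (hmono : StrictMono a) (hsep : ∀ k l, k ≠ l → η < |a k - a l|)
    (ηs : ℕ → ℝ) (hηpos : ∀ j, 0 < ηs j) (hηmono : Monotone ηs)
    (hηlb : ∀ j : ℕ, η * (1 - 1 / ((j : ℝ) + 1) ^ 2) ≤ ηs j) (hηub : ∀ j, ηs j ≤ η)
    :
    dimH (salemCube n N a ηs) = ENNReal.ofReal ((n : ℝ) * β) ∧
      0 < μH[(n : ℝ) * β] (salemCube n N a ηs) ∧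
        packingMeasure ((n : ℝ) * β) (salemCube n N a ηs) < ⊤ := by
  have hη1 : η < 1 := by
    have : (2 : ℝ) ≤ N := by exact_mod_cast hN
    nlinarith
  have hpos := SalemAux.hausdorff_pos n N hN β η hβ0 hη0 hNηβ a ha0 ha1 hsep ηs hηpos hηlb hηub
  have hfin := SalemAux.hausdorff_lt_top n N hn β η hβ0 hη0 hη1 hNηβ a ηs hηpos hηub
  refine ⟨?_, hpos, ?_⟩
  · have hc : (((n : ℝ) * β).toNNReal : ℝ) = n * β := Real.coe_toNNReal _ (by positivity)
    exact dimH_of_hausdorffMeasure_ne_zero_ne_top (d := ((n : ℝ) * β).toNNReal)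
      (by rw [hc]; exact hpos.ne') (by rw [hc]; exact hfin.ne)
  · refine lt_of_le_of_lt ?_ (ENNReal.ofReal_lt_top (r := (2 * n / η) ^ ((n : ℝ) * β)))
    refine (SalemAux.packingMeasure_le _ _).trans ?_
    refine (iInf₂_le 1 one_pos).trans ?_
    refine iSup_le fun t => iSup_le fun h1 => iSup_le fun h2 => ?_
    rw [← ENNReal.ofReal_sum_of_nonneg]
    · exact ENNReal.ofReal_le_ofReal (SalemAux.packing_bound n N hn hN β η hβ0 hη0 hη1 hNηβ a ha0
        ha1 ηs hηpos hηub t h1 h2)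
    · intro p hp
      have := (h1 p hp).2.1
      positivity
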